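/- Let C be a category and R a C-indexed co-ipo with existential quantification, i.e., a C-indexed poset such that every fiber R(c) has a greatest element and meets of all codirected subsets (its opposite is an ipo), and such that every f* : R(d) → R(c) has a left adjoint. Let F be an endofunctor of C and F̂ a lifting of F to ∫R. Then every final F-coalgebra δ : d → F d lifts to a final F̂-coalgebra: there exists ν ∈ R(d) such that δ : (d, ν) → (F d, F̂_d(ν)) is a final F̂-coalgebra in ∫R. -/

import Mathlib

open CategoryTheory

universe w v u

/-- A `C`-indexed poset: a contravariant functor from `C` to posets. -/
structure IndexedPoset (C : Type u) [Category.{v} C] where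
  obj : C → Type w
  po : ∀ c, PartialOrder (obj c)
  map : ∀ {c d : C}, (c ⟶ d) → obj d → obj c
  map_mono : ∀ {c d : C} (f : c ⟶ d), Monotone (map f)
  map_id : ∀ (c : C) (S : obj c), map (𝟙 c) S = S
  map_comp : ∀ {c d e : C} (f : c ⟶ d) (g : d ⟶ e) (S : obj e),
    map (f ≫ g) S = map f (map g S)

attribute [instance] IndexedPoset.po

variable {C : Type u} [Category.{v} C]

/-- The Grothendieck category `∫R` of a `C`-indexed poset `R`. -/
structure Groth (R : IndexedPoset C) where
  base : C
  fib : R.obj base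

instance Groth.category (R : IndexedPoset C) : Category (Groth R) where
  Hom X Y := { f : X.base ⟶ Y.base // X.fib ≤ R.map f Y.fib }
  id X := ⟨𝟙 X.base, (R.map_id X.base X.fib).ge⟩
  comp {X Y Z} f g := ⟨f.val ≫ g.val, by
    rw [R.map_comp]
    exact le_trans f.property (R.map_mono f.val g.property)⟩
  id_comp f := by apply Subtype.ext; simp
  comp_id f := by apply Subtype.ext; simp
  assoc f g h := by apply Subtype.ext; simp

/-- The forgetful functor `U : ∫R ⥤ C`. -/
def grothForget (R : IndexedPoset C) : Groth R ⥤ C where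
  obj X := X.base
  map f := f.val

theorem Groth.eq_mk {R : IndexedPoset C} (X : Groth R) {b : C} (h : X.base = b) :
    X = ⟨b, cast (congrArg R.obj h) X.fib⟩ := by
  cases X
  cases h
  rfl

/-- Given an endofunctor `F̂` of `∫R` lifting `F : C ⥤ C` (i.e. `U ∘ F̂ = F ∘ U`),
the induced fibre map `F̂_c : R(c) → R(F c)`. -/
def liftObj (R : IndexedPoset C) {F : C ⥤ C} (Fhat : Groth R ⥤ Groth R)
    (H : Fhat ⋙ grothForget R = grothForget R ⋙ F) {c : C} (Rc : R.obj c) :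
    R.obj (F.obj c) :=
  cast (congrArg R.obj (Functor.congr_obj H ⟨c, Rc⟩)) (Fhat.obj ⟨c, Rc⟩).fib

/-- Weak dual of Pataraia's theorem: a monotone endofunction of a poset with a greatest element
and codirected meets has a post-fixpoint dominating all post-fixpoints. -/
theorem exists_greatest_le_map {P : Type*} [PartialOrder P]
    (htop : ∃ t : P, ∀ x, x ≤ t)
    (hcodir : ∀ S : Set P, DirectedOn (· ≥ ·) S → ∃ g, IsGLB S g)
    {f : P → P} (hf : Monotone f) :
    ∃ m, m ≤ f m ∧ ∀ x, x ≤ f x → x ≤ m := by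
  obtain ⟨t, ht⟩ := htop
  let A : Set P := {x | f x ≤ x ∧ ∀ y, y ≤ f y → y ≤ x}
  have htA : t ∈ A := ⟨ht _, fun y _ => ht y⟩
  obtain ⟨m, -, hm⟩ := zorn_le_nonempty₀ (α := Pᵒᵈ) (OrderDual.ofDual ⁻¹' A)
    (fun c hcA hc y _ => by
      have hdir : DirectedOn (· ≥ ·) (OrderDual.toDual ⁻¹' c) := fun a ha b hb =>
        hc.directedOn a ha b hb
      obtain ⟨g, hg⟩ := hcodir _ hdir
      exact ⟨OrderDual.toDual g,
        ⟨hg.2 fun s hs => (hf (hg.1 hs)).trans (hcA hs).1,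
          fun z hz => hg.2 fun s hs => (hcA hs).2 z hz⟩,
        fun z hz => hg.1 hz⟩)
    (OrderDual.toDual t) htA
  obtain ⟨hm₁, hm₂⟩ : OrderDual.ofDual m ∈ A := hm.prop
  have hfm : f (OrderDual.ofDual m) ∈ A :=
    ⟨hf hm₁, fun y hy => hy.trans (hf (hm₂ y hy))⟩
  exact ⟨OrderDual.ofDual m, hm.le_of_ge (y := OrderDual.toDual (f (OrderDual.ofDual m))) hfm hm₁,
    hm₂⟩

/-- The morphism of `C` underlying a morphism of `∫R`. -/
def Groth.homBase {R : IndexedPoset C} {X Y : Groth R} (f : X ⟶ Y) : X.base ⟶ Y.base := f.val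

theorem Groth.fib_le {R : IndexedPoset C} {X Y : Groth R} (f : X ⟶ Y) :
    X.fib ≤ R.map (Groth.homBase f) Y.fib := f.property

theorem Groth.hom_ext {R : IndexedPoset C} {X Y : Groth R} {f g : X ⟶ Y}
    (h : Groth.homBase f = Groth.homBase g) : f = g := Subtype.ext h

theorem Groth.homBase_comp {R : IndexedPoset C} {X Y Z : Groth R} (f : X ⟶ Y) (g : Y ⟶ Z) :
    Groth.homBase (f ≫ g) = Groth.homBase f ≫ Groth.homBase g := rfl

theorem Groth.homBase_eqToHom {R : IndexedPoset C} {X Y : Groth R} (h : X = Y) :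
    Groth.homBase (eqToHom h) = eqToHom (congrArg Groth.base h) := by
  cases h
  rfl

section Lifting

variable {R : IndexedPoset C} {F : C ⥤ C} {Fhat : Groth R ⥤ Groth R}

theorem lift_obj_base (H : Fhat ⋙ grothForget R = grothForget R ⋙ F)
    (X : Groth R) : (Fhat.obj X).base = F.obj X.base :=
  Functor.congr_obj H X

variable (H : Fhat ⋙ grothForget R = grothForget R ⋙ F)

theorem lift_obj_eq (X : Groth R) :
    Fhat.obj X = (⟨F.obj X.base, liftObj R Fhat H X.fib⟩ : Groth R) :=
  Groth.eq_mk _ (lift_obj_base H X)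

theorem homBase_lift_map {X Y : Groth R} (f : X ⟶ Y) :
    Groth.homBase (Fhat.map f) = eqToHom (lift_obj_base H X) ≫ F.map (Groth.homBase f) ≫
      eqToHom (lift_obj_base H Y).symm :=
  Functor.congr_hom H f

theorem liftObj_le_map {X Y : Groth R} (f : X ⟶ Y) :
    liftObj R Fhat H X.fib ≤ R.map (F.map (Groth.homBase f)) (liftObj R Fhat H Y.fib) := by
  let ψ : (⟨F.obj X.base, liftObj R Fhat H X.fib⟩ : Groth R) ⟶
      ⟨F.obj Y.base, liftObj R Fhat H Y.fib⟩ :=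
    eqToHom (lift_obj_eq H X).symm ≫ Fhat.map f ≫
      eqToHom (lift_obj_eq H Y)
  have hψ : Groth.homBase ψ = F.map (Groth.homBase f) := by
    simp only [ψ, Groth.homBase_comp, Groth.homBase_eqToHom, homBase_lift_map H]
    simp
  exact hψ ▸ Groth.fib_le ψ

theorem liftObj_mono (c : C) : Monotone (liftObj R Fhat H (c := c)) := fun S T hST => by
  have h := liftObj_le_map H (X := ⟨c, S⟩) (Y := ⟨c, T⟩) ⟨𝟙 c, hST.trans (R.map_id c T).ge⟩
  simpa only [Groth.homBase, F.map_id, R.map_id] using h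

/-- The `F`-coalgebra underlying an `F̂`-coalgebra. -/
def baseCoalgebra (A : Endofunctor.Coalgebra Fhat) : Endofunctor.Coalgebra F where
  V := A.V.base
  str := Groth.homBase A.str ≫ eqToHom (lift_obj_base H A.V)

theorem fib_le_map_baseCoalgebra_str (A : Endofunctor.Coalgebra Fhat) :
    A.V.fib ≤ R.map (baseCoalgebra H A).str (liftObj R Fhat H A.V.fib) := by
  let φ : A.V ⟶ ⟨F.obj A.V.base, liftObj R Fhat H A.V.fib⟩ :=
    A.str ≫ eqToHom (lift_obj_eq H A.V)
  have hφ : Groth.homBase φ = (baseCoalgebra H A).str := by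
    simp only [φ, Groth.homBase_comp, Groth.homBase_eqToHom]
    rfl
  exact hφ ▸ Groth.fib_le φ

/-- A morphism of `∫R` is a homomorphism of `F̂`-coalgebras iff its underlying morphism is a
homomorphism of the underlying `F`-coalgebras. -/
theorem coalgebra_comm_iff {A A' : Endofunctor.Coalgebra Fhat} (g : A.V ⟶ A'.V) :
    A.str ≫ Fhat.map g = g ≫ A'.str ↔
      (baseCoalgebra H A).str ≫ F.map (Groth.homBase g) =
        Groth.homBase g ≫ (baseCoalgebra H A').str := by
  have h₁ : Groth.homBase (A.str ≫ Fhat.map g) = (Groth.homBase A.str ≫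
      eqToHom (lift_obj_base H A.V) ≫ F.map (Groth.homBase g)) ≫
        eqToHom (lift_obj_base H A'.V).symm := by
    rw [Groth.homBase_comp, homBase_lift_map H]
    simp only [Category.assoc]
  have h₂ : (baseCoalgebra H A).str ≫ F.map (Groth.homBase g) =
      Groth.homBase A.str ≫ eqToHom (lift_obj_base H A.V) ≫ F.map (Groth.homBase g) :=
    Category.assoc _ _ _
  have h₃ : Groth.homBase g ≫ (baseCoalgebra H A').str =
      Groth.homBase (g ≫ A'.str) ≫ eqToHom (lift_obj_base H A'.V) :=
    (Category.assoc _ _ _).symm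
  rw [h₂, h₃]
  constructor
  · intro h
    rw [← h, h₁]
    simp
    rfl
  · intro h
    refine Groth.hom_ext ?_
    rw [h₁, h]
    simp

/-- The `F̂`-coalgebra on `(d, ν)` given by an `F`-coalgebra on `d` for which `ν` is a
post-fixpoint. -/
def liftCoalgebra (B : Endofunctor.Coalgebra F) (ν : R.obj B.V)
    (h : ν ≤ R.map B.str (liftObj R Fhat H ν)) : Endofunctor.Coalgebra Fhat :=
  ⟨⟨B.V, ν⟩,
    (⟨B.str, h⟩ : (⟨B.V, ν⟩ : Groth R) ⟶ (⟨F.obj B.V, liftObj R Fhat H ν⟩ : Groth R)) ≫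
      eqToHom (lift_obj_eq H ⟨B.V, ν⟩).symm⟩

theorem baseCoalgebra_liftCoalgebra_str (B : Endofunctor.Coalgebra F) (ν : R.obj B.V)
    (h : ν ≤ R.map B.str (liftObj R Fhat H ν)) :
    (baseCoalgebra H (liftCoalgebra H B ν h)).str = B.str := by
  change (B.str ≫ Groth.homBase (eqToHom (lift_obj_eq H ⟨B.V, ν⟩).symm)) ≫
    eqToHom (lift_obj_base H ⟨B.V, ν⟩) = B.str
  rw [Groth.homBase_eqToHom]
  simp

end Lifting

/-- Corollary: if `R` is a `C`-indexed co-ipo (every fibre has a greatest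
element and meets of codirected subsets) with existential quantification, then
every final `F`-coalgebra lifts to a final `F̂`-coalgebra. -/
theorem final_coalgebra_lifting_coipo (R : IndexedPoset C)
    (htop : ∀ c : C, ∃ tt : R.obj c, ∀ x : R.obj c, x ≤ tt)
    (hcodir : ∀ (c : C) (S : Set (R.obj c)), DirectedOn (· ≥ ·) S → ∃ g, IsGLB S g)
    (hex : ∀ {c d : C} (f : c ⟶ d), ∃ E : R.obj c → R.obj d,
      ∀ (x : R.obj c) (y : R.obj d), E x ≤ y ↔ x ≤ R.map f y)
    (F : C ⥤ C) (Fhat : Groth R ⥤ Groth R)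
    (H : Fhat ⋙ grothForget R = grothForget R ⋙ F)
    (B : Endofunctor.Coalgebra F) (hB : Limits.IsTerminal B) :
    ∃ (ν : R.obj B.V) (h : ν ≤ R.map B.str (liftObj R Fhat H ν)),
      Nonempty (Limits.IsTerminal
        (⟨⟨B.V, ν⟩,
          (⟨B.str, h⟩ :
            (⟨B.V, ν⟩ : Groth R) ⟶ (⟨F.obj B.V, liftObj R Fhat H ν⟩ : Groth R)) ≫
          eqToHom (Groth.eq_mk (Fhat.obj ⟨B.V, ν⟩)
            (Functor.congr_obj H ⟨B.V, ν⟩)).symm⟩ :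
          Endofunctor.Coalgebra Fhat)) := by
  obtain ⟨ν, h, hν⟩ := exists_greatest_le_map (htop B.V) (hcodir B.V)
    (f := fun S => R.map B.str (liftObj R Fhat H S))
    (fun _ _ hST => R.map_mono B.str (liftObj_mono H B.V hST))
  have le_map (A : Endofunctor.Coalgebra Fhat) (g : baseCoalgebra H A ⟶ B) :
      A.V.fib ≤ R.map g.f ν := by
    obtain ⟨E, hE⟩ := hex g.f
    refine (hE _ _).1 (hν _ ((hE _ _).2 ?_))
    rw [← R.map_comp, ← g.h, R.map_comp]
    exact (fib_le_map_baseCoalgebra_str H A).trans (R.map_mono _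
      (liftObj_le_map H (X := A.V) (Y := ⟨B.V, E A.V.fib⟩) ⟨g.f, (hE _ _).1 le_rfl⟩))
  have comm_iff (A : Endofunctor.Coalgebra Fhat) (g : A.V ⟶ (liftCoalgebra H B ν h).V) :
      A.str ≫ Fhat.map g = g ≫ (liftCoalgebra H B ν h).str ↔
        (baseCoalgebra H A).str ≫ F.map (Groth.homBase g) = Groth.homBase g ≫ B.str := by
    rw [coalgebra_comm_iff H, baseCoalgebra_liftCoalgebra_str]
    rfl
  refine ⟨ν, h, ⟨Limits.IsTerminal.ofUniqueHom (Y := liftCoalgebra H B ν h)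
    (fun A => ⟨⟨(hB.from (baseCoalgebra H A)).f, le_map A _⟩,
      (comm_iff A _).2 (hB.from (baseCoalgebra H A)).h⟩) fun A g => ?_⟩⟩
  let g' : baseCoalgebra H A ⟶ B := ⟨Groth.homBase g.f, (comm_iff A g.f).1 g.h⟩
  exact Endofunctor.Coalgebra.Hom.ext (Groth.hom_ext
    (congrArg Endofunctor.Coalgebra.Hom.f (hB.hom_ext g' (hB.from (baseCoalgebra H A)))))
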